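/- Let V be a real inner product space, let Φ : V → ℝ be a linear map, and let χ ∈ V be a vector such that Φ(χ) = ‖χ‖² and such that Φ(v) ≥ −‖χ‖·‖v‖ for every v ∈ V. Then for every α ∈ V one has Φ(α) − ⟨α, χ⟩ ≥ 0. -/

import Mathlib

open RealInnerProductSpace

/-- Abstract inner-product argument for relative K-semistability: if `Φ` is linear,
`Φ χ = ‖χ‖²` and `Φ v ≥ −‖χ‖·‖v‖` for all `v`, then `Φ α − ⟨α, χ⟩ ≥ 0` for all `α`. -/
theorem stmt_3 {V : Type*} [NormedAddCommGroup V] [InnerProductSpace ℝ V]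
    (Φ : V →ₗ[ℝ] ℝ) (χ : V)
    (hχ : Φ χ = ‖χ‖ ^ 2)
    (hlow : ∀ v : V, Φ v ≥ -(‖χ‖ * ‖v‖)) :
    ∀ α : V, Φ α - ⟪α, χ⟫ ≥ 0 := by
  intro α
  by_contra! hneg
  set L := Φ α - ⟪α, χ⟫ with hL
  have key : ∀ t : ℝ, 0 ≤ t * L + t ^ 2 * ‖α‖ ^ 2 / 2 := by
    intro t
    have h := hlow (t • α - χ)
    have hn : ‖t • α - χ‖ ^ 2 = t ^ 2 * ‖α‖ ^ 2 - 2 * (t * ⟪α, χ⟫) + ‖χ‖ ^ 2 := by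
      rw [norm_sub_sq_real, norm_smul, real_inner_smul_left, mul_pow, Real.norm_eq_abs, sq_abs]
    rw [map_sub, map_smul, smul_eq_mul, hχ] at h
    have hamgm := two_mul_le_add_sq ‖χ‖ ‖t • α - χ‖
    rw [hL, mul_sub]
    linarith
  have hpos : 0 < ‖α‖ ^ 2 + 1 := by positivity
  set t := -L / (‖α‖ ^ 2 + 1) with ht
  have ht_pos : 0 < t := div_pos (neg_pos.mpr hneg) hpos
  have htL : t * (‖α‖ ^ 2 + 1) = -L := div_mul_cancel₀ _ hpos.ne'
  have hnonneg : 0 ≤ L + t * ‖α‖ ^ 2 / 2 := by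
    refine nonneg_of_mul_nonneg_right (a := t) ?_ ht_pos
    linarith [key t]
  linarith
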